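/- Let $k$ be an algebraically closed field of characteristic different from $2$ and $3$, and let $V$ be a $k$-vector space of finite dimension $d \neq 1$. A cubic form on $V$ is a function $f : V \to k$ of the form $f(v) = T(v,v,v)$ with $T : V \times V \times V \to k$ symmetric and trilinear; its q-rank $\operatorname{qrank}(f)$ is the least $r \in \mathbb{N}$ for which there are linear functionals $\ell_1,\dots,\ell_r$ and quadratic forms $q_1,\dots,q_r$ on $V$ with $f = \sum_{i=1}^r \ell_i q_i$. Then every cubic form $f$ on $V$ satisfies $$\operatorname{qrank}(f) \le d - \xi(d), \qquad \xi(d) = \left\lfloor \frac{\sqrt{8d+17} - 3}{2} \right\rfloor .$$ -/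

import Mathlib

open scoped BigOperators

/-- The q-rank of a function `f : V → k`: the least `r` such that
`f = ∑ i : Fin r, ℓᵢ · qᵢ` with `ℓᵢ` linear functionals and `qᵢ` quadratic forms,
as an element of `ℕ∞` (`⊤` if no such expression exists). -/
noncomputable def qrank (k : Type*) [Field k] {V : Type*} [AddCommGroup V] [Module k V]
    (f : V → k) : ℕ∞ :=
  sInf {r : ℕ∞ | ∃ m : ℕ, r = m ∧
    ∃ (ℓ : Fin m → (V →ₗ[k] k)) (q : Fin m → QuadraticForm k V),
      ∀ v, f v = ∑ i, ℓ i v * q i v}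

/-- `f : V → k` is a cubic form: `f v = T (v,v,v)` for a symmetric trilinear map `T`. -/
def IsCubicForm (k : Type*) [Field k] {V : Type*} [AddCommGroup V] [Module k V]
    (f : V → k) : Prop :=
  ∃ T : V →ₗ[k] V →ₗ[k] V →ₗ[k] k,
    (∀ x y z, T x y z = T y x z) ∧ (∀ x y z, T x y z = T x z y) ∧ ∀ v, f v = T v v v

/-- `ξ(d) = ⌊(√(8d+17) − 3)/2⌋`; the real number under the floor is positive for all `d`,
so the floor is a natural number. -/
noncomputable def xi (d : ℕ) : ℕ := ⌊(Real.sqrt (8 * (d : ℝ) + 17) - 3) / 2⌋₊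

/-- `ξ(d) ≤ d`, so the natural-number subtraction `d - xi d` is a genuine difference. -/
theorem xi_le (d : ℕ) : xi d ≤ d := by
  unfold xi
  rcases Nat.eq_zero_or_pos d with rfl | hd
  · rw [Nat.le_zero, Nat.floor_eq_zero]
    have h : Real.sqrt 17 < 5 := by
      rw [Real.sqrt_lt' (by norm_num)]; norm_num
    simp only [Nat.cast_zero, mul_zero, zero_add]
    linarith
  · apply Nat.floor_le_of_le
    have h1 : (1 : ℝ) ≤ d := by exact_mod_cast hd
    have : Real.sqrt (8 * (d : ℝ) + 17) ≤ 2 * d + 3 := by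
      rw [Real.sqrt_le_left (by linarith)]; nlinarith
    linarith

/-! ### Specialization of linear subspaces along a valuation ring -/

/-- If `t` is not invertible in `k[t]`, there is a valuation ring containing `k` in which `t` is a
nonunit. -/
theorem exists_valuationSubring_mem_nonunits {k K : Type*} [Field k] [Field K] [Algebra k K]
    (t : K) (ht : ∀ p : Polynomial k, p.aeval t * t ≠ 1) :
    ∃ O : ValuationSubring K, (∀ c, algebraMap k K c ∈ O) ∧ t ∈ O.nonunits := by
  let A : Subalgebra k K := Algebra.adjoin k {t}
  have htA : t ∈ A := Algebra.self_mem_adjoin_singleton k t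
  let t' : A.toSubring := ⟨t, htA⟩
  have hI : Ideal.span {t'} ≠ ⊤ := by
    rw [Ne, Ideal.eq_top_iff_one, Ideal.mem_span_singleton']
    rintro ⟨⟨a, ha⟩, hat⟩
    obtain ⟨p, rfl⟩ : ∃ p : Polynomial k, p.aeval t = a := by
      have ha' : a ∈ Algebra.adjoin k {t} := ha
      rwa [Algebra.adjoin_singleton_eq_range_aeval, AlgHom.mem_range] at ha'
    exact ht p (congrArg Subtype.val hat)
  obtain ⟨O, hAO, hImem⟩ := Ideal.image_subset_nonunits_valuationSubring _ hI
  exact ⟨O, fun c => hAO (A.algebraMap_mem c),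
    hImem ⟨t', Ideal.mem_span_singleton_self t', rfl⟩⟩

/-- A matrix of full row rank over the fraction field of a valuation ring can be row-reduced, by
inverting a square block whose determinant has maximal valuation, to a matrix with entries in the
valuation ring containing an identity block. -/
theorem ValuationSubring.exists_mul_submatrix_eq_one {K : Type*} [Field K] (O : ValuationSubring K)
    {n ι : Type*} [Fintype n] [DecidableEq n] [Finite ι] (M : Matrix n ι K)
    (hM : ∃ e : n → ι, (M.submatrix id e).det ≠ 0) :
    ∃ (P : Matrix n n K) (e : n → ι), (P * M).submatrix id e = 1 ∧ ∀ i a, (P * M) i a ∈ O := by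
  classical
  obtain ⟨e₀, he₀⟩ := hM
  have : Nonempty (n → ι) := ⟨e₀⟩
  obtain ⟨e, he⟩ := Finite.exists_max fun e : n → ι => O.valuation (M.submatrix id e).det
  have hdet : (M.submatrix id e).det ≠ 0 := by
    intro h
    have := he e₀
    rw [h, map_zero, le_zero_iff, map_eq_zero] at this
    exact he₀ this
  refine ⟨(M.submatrix id e)⁻¹, e, ?_, fun i a => ?_⟩
  · rw [← Matrix.nonsing_inv_mul (M.submatrix id e) (isUnit_iff_ne_zero.2 hdet)]
    rfl
  · have h1 : ((M.submatrix id e)⁻¹ * M) i a =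
        (M.submatrix id e).det⁻¹ * (M.submatrix id (Function.update e i a)).det := by
      have h2 : M.submatrix id (Function.update e i a) =
          (M.submatrix id e).updateCol i (fun j => M j a) := by
        ext j l
        by_cases h : l = i
        · subst h; simp
        · simp [h]
      rw [h2, ← Matrix.cramer_apply, Matrix.cramer_eq_adjugate_mulVec, Matrix.inv_def,
        Ring.inverse_eq_inv', Matrix.smul_mul]
      rfl
    rw [h1]
    apply O.mem_of_valuation_le_one
    rw [map_mul, map_inv₀, inv_mul_le_one₀ (by simpa [zero_lt_iff] using hdet)]
    exact he _

/-- Finitely many elements of a valuation ring over an algebraically closed field `k` generate a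
`k`-algebra having a `k`-point at which a given nonunit generator vanishes. -/
theorem ValuationSubring.exists_algHom_adjoin {k K : Type*} [Field k] [IsAlgClosed k] [Field K]
    [Algebra k K] (O : ValuationSubring K) (hO : ∀ c, algebraMap k K c ∈ O) {t : K}
    (ht : t ∈ O.nonunits) {S : Set K} (hS : S.Finite) (hSO : ∀ x ∈ S, x ∈ O) (htS : t ∈ S) :
    ∃ ρ : Algebra.adjoin k S →ₐ[k] k, ρ ⟨t, Algebra.subset_adjoin htS⟩ = 0 := by
  let B := Algebra.adjoin k S
  have hB : ∀ x ∈ B, x ∈ O := by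
    let O' : Subalgebra k K := { O.toSubring with algebraMap_mem' := hO }
    have : B ≤ O' := Algebra.adjoin_le hSO
    exact fun x hx => this hx
  let t' : B := ⟨t, Algebra.subset_adjoin htS⟩
  have hI : Ideal.span {t'} ≠ ⊤ := by
    rw [Ne, Ideal.eq_top_iff_one, Ideal.mem_span_singleton']
    rintro ⟨⟨a, ha⟩, hat⟩
    have hat' : a * t = 1 := congrArg Subtype.val hat
    rcases O.mem_nonunits_iff_or.1 ht with h0 | h0
    · simp [h0] at hat'
    · exact h0 (by rw [← eq_inv_of_mul_eq_one_left hat']; exact hB a ha)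
  obtain ⟨m, hm, hle⟩ := Ideal.exists_le_maximal _ hI
  have : Algebra.FiniteType k B :=
    (Subalgebra.fg_iff_finiteType _).1 ⟨hS.toFinset, by simp [B]⟩
  let : Field (B ⧸ m) := Ideal.Quotient.field m
  have : Algebra.FiniteType k (B ⧸ m) :=
    Algebra.FiniteType.of_surjective (Ideal.Quotient.mkₐ k m) (Ideal.Quotient.mkₐ_surjective k m)
  have := finite_of_finite_type_of_isJacobsonRing k (B ⧸ m)
  let σ : k ≃ₐ[k] (B ⧸ m) := AlgEquiv.ofBijective (Algebra.ofId k (B ⧸ m))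
    IsAlgClosed.algebraMap_bijective_of_isIntegral
  refine ⟨σ.symm.toAlgHom.comp (Ideal.Quotient.mkₐ k m), ?_⟩
  have : Ideal.Quotient.mkₐ k m t' = 0 :=
    Ideal.Quotient.eq_zero_iff_mem.2 (hle (Ideal.mem_span_singleton_self t'))
  rw [AlgHom.comp_apply]
  change σ.symm.toAlgHom (Ideal.Quotient.mkₐ k m t') = 0
  rw [this, map_zero]

/-! ### Trilinear forms in coordinates -/

/-- The trilinear form on `ι → A` with coefficients `τ`. -/
def trilinEval {ι A : Type*} [Fintype ι] [CommRing A] (τ : ι → ι → ι → A) (x y z : ι → A) : A :=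
  ∑ a, ∑ b, ∑ c, τ a b c * (x a * (y b * z c))

section trilinEval

variable {ι A B : Type*} [Fintype ι] [CommRing A] [CommRing B]

theorem map_trilinEval (ρ : A →+* B) (τ : ι → ι → ι → A) (x y z : ι → A) :
    ρ (trilinEval τ x y z) = trilinEval (fun a b c => ρ (τ a b c))
      (fun a => ρ (x a)) (fun a => ρ (y a)) (fun a => ρ (z a)) := by
  simp [trilinEval]

theorem trilinEval_add (τ σ : ι → ι → ι → A) (r : A) (x y z : ι → A) :
    trilinEval (fun a b c => τ a b c + r * σ a b c) x y z =
      trilinEval τ x y z + r * trilinEval σ x y z := by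
  simp only [trilinEval, add_mul, Finset.sum_add_distrib, Finset.mul_sum, mul_assoc]

theorem trilinEval_swap_left {τ : ι → ι → ι → A} (h : ∀ a b c, τ a b c = τ b a c)
    (x y z : ι → A) : trilinEval τ x y z = trilinEval τ y x z := by
  unfold trilinEval
  rw [Finset.sum_comm]
  refine Finset.sum_congr rfl fun a _ => Finset.sum_congr rfl fun b _ =>
    Finset.sum_congr rfl fun c _ => ?_
  rw [h b a c, mul_left_comm (x b)]

theorem trilinEval_swap_right {τ : ι → ι → ι → A} (h : ∀ a b c, τ a b c = τ a c b)
    (x y z : ι → A) : trilinEval τ x y z = trilinEval τ x z y := by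
  unfold trilinEval
  refine Finset.sum_congr rfl fun a _ => ?_
  rw [Finset.sum_comm]
  refine Finset.sum_congr rfl fun b _ => Finset.sum_congr rfl fun c _ => ?_
  rw [h a c b, mul_comm (y c)]

/-- `trilinEval` as a bundled trilinear map. -/
def trilinMap (τ : ι → ι → ι → A) : (ι → A) →ₗ[A] (ι → A) →ₗ[A] (ι → A) →ₗ[A] A :=
  ∑ a, ∑ b, ∑ c, τ a b c • (LinearMap.proj a).smulRight ((LinearMap.proj b).smulRight
    (LinearMap.proj c : (ι → A) →ₗ[A] A))

theorem trilinMap_apply (τ : ι → ι → ι → A) (x y z : ι → A) :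
    trilinMap τ x y z = trilinEval τ x y z := by
  simp [trilinMap, trilinEval]

/-- Vanishing of a trilinear form on the rows of `M` is inherited by the rows of `P * M`. -/
theorem trilinEval_mul_eq_zero {n : Type*} [Fintype n] (τ : ι → ι → ι → A) (M : Matrix n ι A)
    (h : ∀ i j l, trilinEval τ (M i) (M j) (M l) = 0) (P : Matrix n n A) (i j l : n) :
    trilinEval τ ((P * M) i) ((P * M) j) ((P * M) l) = 0 := by
  have hrow : ∀ i, (P * M) i = ∑ j, P i j • M j := fun i => by
    ext a; simp [Matrix.mul_apply]
  rw [← trilinMap_apply, hrow, hrow, hrow]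
  simp [trilinMap_apply, h]

end trilinEval

/-- If a family `τ + t γ` of trilinear forms vanishes on a `n`-dimensional space over a field
containing `k[t]`, with `t` not invertible in `k[t]`, then `τ` vanishes on a `n`-dimensional space
over `k`. -/
theorem exists_linearIndependent_trilinEval_eq_zero {k K : Type*} [Field k] [IsAlgClosed k]
    [Field K] [Algebra k K] {n ι : Type*} [Fintype n] [DecidableEq n] [Fintype ι]
    (t : K) (ht : ∀ p : Polynomial k, p.aeval t * t ≠ 1) (τ γ : ι → ι → ι → k) (M : Matrix n ι K)
    (hM : ∃ e : n → ι, (M.submatrix id e).det ≠ 0)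
    (h : ∀ i j l, trilinEval (fun a b c => algebraMap k K (τ a b c) + t * algebraMap k K (γ a b c))
      (M i) (M j) (M l) = 0) :
    ∃ N : n → ι → k, LinearIndependent k N ∧ ∀ i j l, trilinEval τ (N i) (N j) (N l) = 0 := by
  obtain ⟨O, hO, htO⟩ := exists_valuationSubring_mem_nonunits t ht
  obtain ⟨P, e, hPe, hPO⟩ := O.exists_mul_submatrix_eq_one M hM
  let S : Set K := insert t (Set.range fun x : n × ι => (P * M) x.1 x.2)
  obtain ⟨ρ, hρ⟩ := O.exists_algHom_adjoin (S := S) hO htO ((Set.finite_range _).insert t)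
    (by rintro x (rfl | ⟨y, rfl⟩); exacts [O.nonunits_subset htO, hPO _ _]) (Set.mem_insert _ _)
  let t' : Algebra.adjoin k S := ⟨t, Algebra.subset_adjoin (Set.mem_insert _ _)⟩
  let Q : n → ι → Algebra.adjoin k S := fun i a =>
    ⟨(P * M) i a, Algebra.subset_adjoin (Set.mem_insert_of_mem _ ⟨(i, a), rfl⟩)⟩
  have hQ : ∀ i j l, trilinEval (fun a b c => algebraMap k (Algebra.adjoin k S) (τ a b c) +
      t' * algebraMap k (Algebra.adjoin k S) (γ a b c)) (Q i) (Q j) (Q l) = 0 := by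
    intro i j l
    apply Subtype.val_injective
    have h1 := trilinEval_mul_eq_zero _ M h P i j l
    exact (map_trilinEval (Algebra.adjoin k S).val.toRingHom _ _ _ _).trans h1
  refine ⟨fun i a => ρ (Q i a), ?_, fun i j l => ?_⟩
  · have hone : ∀ i j, ρ (Q i (e j)) = (1 : Matrix n n k) i j := by
      intro i j
      have h1 : Q i (e j) = (1 : Matrix n n (Algebra.adjoin k S)) i j := by
        apply Subtype.val_injective
        have := congrFun (congrFun hPe i) j
        refine this.trans ?_
        by_cases hij : i = j
        · subst hij; simp
        · simp [hij]
      rw [h1]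
      by_cases hij : i = j
      · subst hij; simp
      · simp [hij]
    rw [Fintype.linearIndependent_iff]
    intro g hg j
    have := congrFun hg (e j)
    simpa [hone, Matrix.one_apply] using this
  · have h1 := congrArg ρ (hQ i j l)
    rw [map_zero] at h1
    have h2 := (map_trilinEval ρ.toRingHom _ _ _ _).symm.trans h1
    have hρ' : ρ t' = 0 := hρ
    simpa [hρ'] using h2

/-! ### Solving a deformed system over power series -/

/-- A system `Φ = X * P Φ` has a solution in power series if `P` preserves `X`-adic congruences. -/
theorem PowerSeries.exists_eq_X_mul {k E : Type*} [CommRing k]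
    (P : (E → PowerSeries k) → E → PowerSeries k)
    (hP : ∀ (n : ℕ) (x y : E → PowerSeries k), (∀ e, PowerSeries.X ^ n ∣ x e - y e) →
      ∀ e, PowerSeries.X ^ n ∣ P x e - P y e) :
    ∃ Φ : E → PowerSeries k, ∀ e, Φ e = PowerSeries.X * P Φ e := by
  let Ψ : ℕ → E → PowerSeries k := fun n => (fun x e => PowerSeries.X * P x e)^[n] 0
  have hΨ : ∀ n e, Ψ (n + 1) e = PowerSeries.X * P (Ψ n) e := fun n e => by
    simp only [Ψ, Function.iterate_succ_apply']
  have hstep : ∀ n e, PowerSeries.X ^ n ∣ Ψ (n + 1) e - Ψ n e := by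
    intro n
    induction n with
    | zero => intro e; simp
    | succ n ih =>
      intro e
      rw [hΨ (n + 1), hΨ n, ← mul_sub, pow_succ']
      exact mul_dvd_mul_left _ (hP n _ _ ih e)
  have hle : ∀ m n e, m ≤ n → PowerSeries.X ^ m ∣ Ψ n e - Ψ m e := by
    intro m n e hmn
    induction n, hmn using Nat.le_induction with
    | base => simp
    | succ n hmn ih =>
      rw [← sub_add_sub_cancel _ (Ψ n e)]
      exact dvd_add ((pow_dvd_pow _ hmn).trans (hstep n e)) ih
  let Φ : E → PowerSeries k := fun e => PowerSeries.mk fun n => PowerSeries.coeff n (Ψ (n + 1) e)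
  have hΦ : ∀ n e, PowerSeries.X ^ n ∣ Φ e - Ψ n e := by
    intro n e
    rw [PowerSeries.X_pow_dvd_iff]
    intro m hm
    have := PowerSeries.X_pow_dvd_iff.1 (hle (m + 1) n e hm) m (Nat.lt_succ_self m)
    rw [map_sub] at this ⊢
    rw [PowerSeries.coeff_mk, ← neg_sub, this, neg_zero]
  refine ⟨Φ, fun e => ?_⟩
  have hdvd : ∀ n, PowerSeries.X ^ n ∣ Φ e - PowerSeries.X * P Φ e := by
    intro n
    have h1 := (pow_dvd_pow PowerSeries.X n.le_succ).trans (hΦ (n + 1) e)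
    have h2 := (hP n _ _ (hΦ n) e).mul_left PowerSeries.X
    convert dvd_sub h1 h2 using 1
    rw [hΨ]; ring
  rw [← sub_eq_zero]
  ext n
  simpa using PowerSeries.X_pow_dvd_iff.1 (hdvd (n + 1)) n (Nat.lt_succ_self n)

section Deformation

variable {n : Type*} [DecidableEq n] {p₀ : Sym2 n}

/-- The symmetric coefficients of the cubic form `∑ u_{jl} w_j w_l`, the sum being over ordered
pairs `(j, l)` with `s(j, l) ≠ p₀`, in the variables `w_j` and `u_p`, `p ≠ p₀`. -/
def pairingCoeff (A : Type*) [CommRing A] (p₀ : Sym2 n) :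
    n ⊕ {p : Sym2 n // p ≠ p₀} → n ⊕ {p : Sym2 n // p ≠ p₀} → n ⊕ {p : Sym2 n // p ≠ p₀} → A
  | .inr p, .inl j, .inl l => if p.1 = s(j, l) then 1 else 0
  | .inl i, .inr p, .inl l => if p.1 = s(i, l) then 1 else 0
  | .inl i, .inl j, .inr p => if p.1 = s(i, j) then 1 else 0
  | _, _, _ => 0

theorem map_pairingCoeff {A B : Type*} [CommRing A] [CommRing B] (f : A →+* B)
    (a b c : n ⊕ {p : Sym2 n // p ≠ p₀}) :
    f (pairingCoeff A p₀ a b c) = pairingCoeff B p₀ a b c := by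
  rcases a with a | a <;> rcases b with b | b <;> rcases c with c | c <;>
    simp [pairingCoeff, apply_ite f]

/-- The rows of the matrix `(1 | Φ)`, whose row space is the graph of `Φ`. -/
def graphRow {A : Type*} [CommRing A] (Φ : n → {p : Sym2 n // p ≠ p₀} → A) (i : n) :
    n ⊕ {p : Sym2 n // p ≠ p₀} → A :=
  Sum.elim (Pi.single i 1) (Φ i)

/-- Extension by zero of a function on pairs `p ≠ p₀`. -/
def extendPair {A : Type*} [CommRing A] (φ : {p : Sym2 n // p ≠ p₀} → A) (p : Sym2 n) : A :=
  if h : p ≠ p₀ then φ ⟨p, h⟩ else 0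

theorem sum_ite_extendPair [Fintype n] {A : Type*} [CommRing A]
    (φ : {p : Sym2 n // p ≠ p₀} → A) (p : Sym2 n) :
    ∑ q : {p : Sym2 n // p ≠ p₀}, (if q.1 = p then φ q else 0) = extendPair φ p := by
  unfold extendPair
  split_ifs with h
  · rw [Finset.sum_eq_single ⟨p, h⟩]
    · simp
    · intro q _ hq
      rw [if_neg]
      exact fun h' => hq (Subtype.ext h')
    · simp
  · refine Finset.sum_eq_zero fun q _ => if_neg fun h' => h fun h'' => q.2 (h'.trans h'')

theorem trilinEval_pairingCoeff_graphRow [Fintype n] {A : Type*} [CommRing A]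
    (Φ : n → {p : Sym2 n // p ≠ p₀} → A) (i j l : n) :
    trilinEval (pairingCoeff A p₀) (graphRow Φ i) (graphRow Φ j) (graphRow Φ l) =
      extendPair (Φ i) s(j, l) + extendPair (Φ j) s(i, l) + extendPair (Φ l) s(i, j) := by
  simp only [← sum_ite_extendPair]
  simp [trilinEval, pairingCoeff, graphRow, Fintype.sum_sum_type, Pi.single_apply,
    Finset.sum_add_distrib]

variable (k : Type*) [Field k]

/-- The indicator of `p ≠ p₀`. -/
def pairWeight (p₀ p : Sym2 n) : k := if p = p₀ then 0 else 1

/-- The number of pairs different from `p₀` in the triple `i, j, l`. -/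
def tripleWeight (p₀ : Sym2 n) (i j l : n) : k :=
  pairWeight k p₀ s(j, l) + pairWeight k p₀ s(i, l) + pairWeight k p₀ s(i, j)

variable {k}

theorem tripleWeight_ne_zero (h2 : (2 : k) ≠ 0) (h3 : (3 : k) ≠ 0) {u v : n} (huv : u ≠ v)
    (i j l : n) : tripleWeight k s(u, v) i j l ≠ 0 := by
  have h2' : (1 + 1 : k) ≠ 0 := by rwa [one_add_one_eq_two]
  have h3' : (1 + 1 + 1 : k) ≠ 0 := by rwa [one_add_one_eq_two, two_add_one_eq_three]
  unfold tripleWeight pairWeight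
  split_ifs with h1 h4 h5 <;> simp_all
  grind

theorem tripleWeight_swap_left (i j l : n) :
    tripleWeight k p₀ i j l = tripleWeight k p₀ j i l := by
  simp only [tripleWeight, Sym2.eq_swap (a := j) (b := i)]; ring

theorem tripleWeight_swap_right (i j l : n) :
    tripleWeight k p₀ i j l = tripleWeight k p₀ i l j := by
  simp only [tripleWeight, Sym2.eq_swap (a := l) (b := j)]; ring

/-- For a symmetric trilinear form `τ`, the deformation `X τ + γ` of the pairing form `γ` vanishes
on the graph of some `Φ` over power series. -/
theorem exists_graphRow_trilinEval_add_eq_zero [Fintype n] (h2 : (2 : k) ≠ 0) (h3 : (3 : k) ≠ 0)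
    {u v : n} (huv : u ≠ v)
    (τ : n ⊕ {p : Sym2 n // p ≠ s(u, v)} → n ⊕ {p : Sym2 n // p ≠ s(u, v)} →
      n ⊕ {p : Sym2 n // p ≠ s(u, v)} → k)
    (hτ₁ : ∀ a b c, τ a b c = τ b a c) (hτ₂ : ∀ a b c, τ a b c = τ a c b) :
    ∃ Φ : n → {p : Sym2 n // p ≠ s(u, v)} → PowerSeries k, ∀ i j l,
      PowerSeries.X * trilinEval (fun a b c => algebraMap k (PowerSeries k) (τ a b c))
        (graphRow Φ i) (graphRow Φ j) (graphRow Φ l) +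
      trilinEval (pairingCoeff (PowerSeries k) s(u, v))
        (graphRow Φ i) (graphRow Φ j) (graphRow Φ l) = 0 := by
  let τ' : n ⊕ {p : Sym2 n // p ≠ s(u, v)} → n ⊕ {p : Sym2 n // p ≠ s(u, v)} →
      n ⊕ {p : Sym2 n // p ≠ s(u, v)} → PowerSeries k := fun a b c => algebraMap k _ (τ a b c)
  let C : (n → {p : Sym2 n // p ≠ s(u, v)} → PowerSeries k) → n → n → n → PowerSeries k := fun Φ i j l =>
    -(algebraMap k (PowerSeries k) (tripleWeight k s(u, v) i j l)⁻¹ *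
      trilinEval τ' (graphRow Φ i) (graphRow Φ j) (graphRow Φ l))
  have hC₁ : ∀ Φ i j l, C Φ i j l = C Φ j i l := fun Φ i j l => by
    simp only [C, tripleWeight_swap_left i j l]
    rw [trilinEval_swap_left fun a b c => by simp only [τ', hτ₁ a b c]]
  have hC₂ : ∀ Φ i j l, C Φ i j l = C Φ i l j := fun Φ i j l => by
    simp only [C, tripleWeight_swap_right i j l]
    rw [trilinEval_swap_right fun a b c => by simp only [τ', hτ₂ a b c]]
  obtain ⟨Φ', hΦ'⟩ := PowerSeries.exists_eq_X_mul (k := k) (E := n × {p : Sym2 n // p ≠ s(u, v)})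
    (fun Φ e => C (fun i p => Φ (i, p)) e.1 e.2.1.out.1 e.2.1.out.2) (by
      intro m x y hxy e
      rw [← Ideal.mem_span_singleton, ← Ideal.Quotient.eq]
      have hrow : ∀ i a, Ideal.Quotient.mk (Ideal.span {(PowerSeries.X : PowerSeries k) ^ m})
          (graphRow (fun i p => x (i, p)) i a) =
          Ideal.Quotient.mk _ (graphRow (fun i p => y (i, p)) i a) := by
        rintro i (a | a)
        · rfl
        · rw [Ideal.Quotient.eq, Ideal.mem_span_singleton]
          exact hxy (i, a)
      simp only [C, map_neg, map_mul, map_trilinEval, hrow])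
  let Φ : n → {p : Sym2 n // p ≠ s(u, v)} → PowerSeries k := fun i p => Φ' (i, p)
  have hext : ∀ i j l, extendPair (Φ i) s(j, l) = PowerSeries.X *
      (algebraMap k _ (pairWeight k s(u, v) s(j, l)) * C Φ i j l) := by
    intro i j l
    unfold extendPair pairWeight
    by_cases h : s(j, l) = s(u, v)
    · simp [h]
    · rw [dif_pos h, if_neg h, map_one, one_mul]
      refine (hΦ' (i, ⟨s(j, l), h⟩)).trans ?_
      congr 1
      have hout : s((s(j, l)).out.1, (s(j, l)).out.2) = s(j, l) := Quot.out_eq _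
      change C Φ i (s(j, l)).out.1 (s(j, l)).out.2 = _
      rcases Sym2.eq_iff.1 hout with ⟨ha, hb⟩ | ⟨ha, hb⟩
      · rw [ha, hb]
      · rw [ha, hb, hC₂]
  refine ⟨Φ, fun i j l => ?_⟩
  rw [trilinEval_pairingCoeff_graphRow, hext, hext, hext, hC₁ Φ j i l, hC₂ Φ l i j,
    hC₁ Φ l j i, hC₂ Φ j l i, hC₁ Φ j i l]
  have hw : algebraMap k (PowerSeries k) (tripleWeight k s(u, v) i j l) *
      algebraMap k (PowerSeries k) (tripleWeight k s(u, v) i j l)⁻¹ = 1 := by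
    rw [← map_mul, mul_inv_cancel₀ (tripleWeight_ne_zero h2 h3 huv i j l), map_one]
  have hw' : algebraMap k (PowerSeries k) (tripleWeight k s(u, v) i j l) * C Φ i j l =
      - trilinEval τ' (graphRow Φ i) (graphRow Φ j) (graphRow Φ l) := by
    simp only [C]
    rw [mul_neg, ← mul_assoc, hw, one_mul]
  rw [tripleWeight, map_add, map_add] at hw'
  linear_combination PowerSeries.X * hw'

end Deformation

/-- The inverse of the power series variable is not invertible in the algebra it generates. -/
theorem aeval_inv_X_mul_ne_one {k : Type*} [Field k] (p : Polynomial k) :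
    p.aeval (algebraMap (PowerSeries k) (FractionRing (PowerSeries k)) PowerSeries.X)⁻¹ *
      (algebraMap (PowerSeries k) (FractionRing (PowerSeries k)) PowerSeries.X)⁻¹ ≠ 1 := by
  set x := algebraMap (PowerSeries k) (FractionRing (PowerSeries k)) PowerSeries.X with hx
  have hx0 : x ≠ 0 := by
    rw [hx, Ne, FaithfulSMul.algebraMap_eq_zero_iff]; exact PowerSeries.X_ne_zero
  intro h
  let := invertibleOfNonzero (inv_ne_zero hx0)
  have h1 := Polynomial.eval₂_reverse_mul_pow (algebraMap k (FractionRing (PowerSeries k))) x⁻¹ p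
  have h2 : p.reverse.eval₂ (algebraMap k (FractionRing (PowerSeries k))) x =
      algebraMap (PowerSeries k) _ (p.reverse : PowerSeries k) := by
    induction p.reverse using Polynomial.induction_on' with
    | add q r hq hr => rw [Polynomial.eval₂_add, hq, hr, Polynomial.coe_add, map_add]
    | monomial m c =>
      rw [Polynomial.eval₂_monomial, ← Polynomial.C_mul_X_pow_eq_monomial, Polynomial.coe_mul,
        Polynomial.coe_pow, Polynomial.coe_X, Polynomial.coe_C, map_mul, map_pow,
        IsScalarTower.algebraMap_apply k (PowerSeries k)]
      rfl
  rw [invOf_eq_inv, inv_inv, h2, ← Polynomial.aeval_def] at h1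
  rw [← h1, mul_assoc, ← pow_succ, inv_pow, ← div_eq_mul_inv,
    div_eq_one_iff_eq (pow_ne_zero _ hx0), hx, ← map_pow] at h
  have h3 := congrArg (PowerSeries.coeff (p.natDegree + 1))
    (FaithfulSMul.algebraMap_injective (PowerSeries k) (FractionRing (PowerSeries k)) h)
  rw [Polynomial.coeff_coe, PowerSeries.coeff_X_pow_self, Polynomial.coeff_eq_zero_of_natDegree_lt
    (Nat.lt_succ_of_le p.reverse_natDegree_le)] at h3
  exact zero_ne_one h3

/-! ### Linear subspaces on which a cubic form vanishes -/

/-- A symmetric trilinear form in `n + n(n+1)/2 - 1` variables, `n ≥ 2`, vanishes on a subspace of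
dimension `n`. -/
theorem exists_linearIndependent_of_symmetric {k : Type*} [Field k] [IsAlgClosed k]
    (h2 : (2 : k) ≠ 0) (h3 : (3 : k) ≠ 0) {n : Type*} [Fintype n] [DecidableEq n] {u v : n}
    (huv : u ≠ v)
    (τ : n ⊕ {p : Sym2 n // p ≠ s(u, v)} → n ⊕ {p : Sym2 n // p ≠ s(u, v)} →
      n ⊕ {p : Sym2 n // p ≠ s(u, v)} → k)
    (hτ₁ : ∀ a b c, τ a b c = τ b a c) (hτ₂ : ∀ a b c, τ a b c = τ a c b) :
    ∃ N : n → n ⊕ {p : Sym2 n // p ≠ s(u, v)} → k, LinearIndependent k N ∧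
      ∀ i j l, trilinEval τ (N i) (N j) (N l) = 0 := by
  obtain ⟨Φ, hΦ⟩ := exists_graphRow_trilinEval_add_eq_zero h2 h3 huv τ hτ₁ hτ₂
  let K := FractionRing (PowerSeries k)
  let x : K := algebraMap (PowerSeries k) K PowerSeries.X
  have hx0 : x ≠ 0 := by
    rw [Ne, FaithfulSMul.algebraMap_eq_zero_iff]; exact PowerSeries.X_ne_zero
  refine exists_linearIndependent_trilinEval_eq_zero x⁻¹ aeval_inv_X_mul_ne_one τ
    (pairingCoeff k s(u, v)) (fun i a => algebraMap (PowerSeries k) K (graphRow Φ i a))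
    ⟨Sum.inl, ?_⟩ fun i j l => ?_
  · have : (Matrix.submatrix (fun i a => algebraMap (PowerSeries k) K (graphRow Φ i a)) id
        Sum.inl : Matrix n n K) = 1 := by
      ext i j
      by_cases hij : i = j
      · subst hij; simp [Matrix.submatrix, graphRow]
      · simp [Matrix.submatrix, graphRow, hij]
    rw [this, Matrix.det_one]
    exact one_ne_zero
  · have h := congrArg (algebraMap (PowerSeries k) K) (hΦ i j l)
    rw [map_zero, map_add, map_mul, map_trilinEval, map_trilinEval] at h
    simp only [map_pairingCoeff, ← IsScalarTower.algebraMap_apply k (PowerSeries k) K] at h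
    rw [trilinEval_add]
    simp only [map_pairingCoeff]
    apply (mul_right_injective₀ hx0)
    simp only [mul_zero]
    rw [mul_add, ← mul_assoc, mul_inv_cancel₀ hx0, one_mul]
    exact h

section CubicForm

variable {k V : Type*} [Field k] [AddCommGroup V] [Module k V]

/-- A symmetric trilinear map on a space of large dimension vanishes on a subspace of dimension
`s ≥ 2`. -/
theorem exists_linearIndependent_trilinear_eq_zero [IsAlgClosed k] [FiniteDimensional k V]
    (h2 : (2 : k) ≠ 0) (h3 : (3 : k) ≠ 0) (T : V →ₗ[k] V →ₗ[k] V →ₗ[k] k)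
    (hT₁ : ∀ x y z, T x y z = T y x z) (hT₂ : ∀ x y z, T x y z = T x z y) {s : ℕ} (hs : 2 ≤ s)
    (hd : s * s + 3 * s ≤ 2 * Module.finrank k V + 2) :
    ∃ w : Fin s → V, LinearIndependent k w ∧ ∀ i j l, T (w i) (w j) (w l) = 0 := by
  let u : Fin s := ⟨0, by omega⟩
  let v : Fin s := ⟨1, by omega⟩
  have huv : u ≠ v := by simp [u, v]
  have hcard : Fintype.card (Fin s ⊕ {p : Sym2 (Fin s) // p ≠ s(u, v)}) ≤ Module.finrank k V := by
    have h : (s + 1).choose 2 * 2 = (s + 1) * s := by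
      rw [Nat.choose_two_right, Nat.add_sub_cancel,
        Nat.div_mul_cancel (by rw [mul_comm]; exact (Nat.even_mul_succ_self s).two_dvd)]
    rw [Fintype.card_sum, Fintype.card_subtype_compl, Sym2.card, Fintype.card_fin,
      Fintype.card_unique]
    have h' : (s + 1) * s = s * s + s := by ring
    omega
  obtain ⟨b, hb⟩ : ∃ b : Fin s ⊕ {p : Sym2 (Fin s) // p ≠ s(u, v)} → V,
      LinearIndependent k b := by
    let B := Module.finBasis k V
    obtain ⟨e⟩ : Nonempty (Fin s ⊕ {p : Sym2 (Fin s) // p ≠ s(u, v)} ↪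
        Fin (Module.finrank k V)) :=
      Function.Embedding.nonempty_of_card_le (by simpa using hcard)
    exact ⟨B ∘ e, B.linearIndependent.comp e e.injective⟩
  obtain ⟨N, hN, hN0⟩ := exists_linearIndependent_of_symmetric h2 h3 huv
    (fun a c e => T (b a) (b c) (b e)) (fun _ _ _ => hT₁ _ _ _) (fun _ _ _ => hT₂ _ _ _)
  refine ⟨fun i => Fintype.linearCombination k b (N i),
    hN.map' _ (LinearMap.ker_eq_bot.2 hb.fintypeLinearCombination_injective), fun i j l => ?_⟩
  rw [← hN0 i j l]
  simp only [Fintype.linearCombination_apply, map_sum, map_smul, LinearMap.sum_apply,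
    LinearMap.smul_apply, trilinEval, Finset.smul_sum, smul_eq_mul, Finset.mul_sum]
  rw [Finset.sum_comm, Finset.sum_congr rfl fun _ _ => Finset.sum_comm, Finset.sum_comm]
  refine Finset.sum_congr rfl fun a _ => Finset.sum_congr rfl fun c _ =>
    Finset.sum_congr rfl fun e _ => ?_
  ring

/-- A cubic form in at least two variables over an algebraically closed field has a nontrivial
zero. -/
theorem exists_ne_zero_trilinear_eq_zero [IsAlgClosed k] [FiniteDimensional k V]
    (T : V →ₗ[k] V →ₗ[k] V →ₗ[k] k) (hd : 1 < Module.finrank k V) :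
    ∃ w : V, w ≠ 0 ∧ T w w w = 0 := by
  obtain ⟨x, hx⟩ : ∃ x : V, x ≠ 0 := by
    have := Module.nontrivial_of_finrank_pos (R := k) (M := V) (by omega)
    exact exists_ne 0
  by_cases hTx : T x x x = 0
  · exact ⟨x, hx, hTx⟩
  obtain ⟨y, hy⟩ : ∃ y : V, y ∉ Submodule.span k {x} := by
    by_contra! h
    have h1 : Submodule.span k {x} = ⊤ := by ext; simp [h]
    have h2 := finrank_span_singleton (K := k) hx
    rw [h1, finrank_top] at h2
    omega
  open Polynomial in
  let p : k[X] := C (T x x x) * X ^ 3 + C (T x x y + T x y x + T y x x) * X ^ 2 +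
    C (T x y y + T y x y + T y y x) * X + C (T y y y)
  have hp : p.degree ≠ 0 := by
    rw [Polynomial.degree_cubic hTx]; decide
  obtain ⟨t, ht⟩ := IsAlgClosed.exists_root p hp
  refine ⟨y + t • x, fun h => hy ?_, ?_⟩
  · rw [eq_neg_of_add_eq_zero_left h]
    exact neg_mem (Submodule.smul_mem _ _ (Submodule.mem_span_singleton_self x))
  · rw [← ht]
    simp [p]
    ring

/-- If a symmetric trilinear form vanishes on an `s`-dimensional subspace, the q-rank of its cubic
form is at most the codimension. -/
theorem qrank_le_of_linearIndependent [FiniteDimensional k V]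
    (T : V →ₗ[k] V →ₗ[k] V →ₗ[k] k)
    (hT₁ : ∀ x y z, T x y z = T y x z) (hT₂ : ∀ x y z, T x y z = T x z y) {s : ℕ}
    (w : Fin s → V) (hw : LinearIndependent k w) (h : ∀ i j l, T (w i) (w j) (w l) = 0) :
    qrank k (fun v => T v v v) ≤ ((Module.finrank k V - s : ℕ) : ℕ∞) := by
  let W := Submodule.span k (Set.range w)
  have hW : ∀ x ∈ W, T x x x = 0 := by
    intro x hx
    obtain ⟨c, rfl⟩ := (Submodule.mem_span_range_iff_exists_fun k).1 hx
    simp [h]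
  obtain ⟨U, hU⟩ := W.exists_isCompl
  have hr : Module.finrank k U = Module.finrank k V - s := by
    have h1 := Submodule.finrank_add_eq_of_isCompl hU
    have h2 : Module.finrank k W = s := by simpa using finrank_span_eq_card hw
    omega
  let B : Module.Basis (Fin (Module.finrank k V - s)) k U := Module.finBasisOfFinrankEq k U hr
  let π : V →ₗ[k] U := U.projectionOnto W hU.symm
  let P : V →ₗ[k] V := LinearMap.id - U.subtype ∘ₗ π
  have hP : ∀ v, P v ∈ W := by
    intro v
    rw [← Submodule.projectionOnto_apply_eq_zero_iff hU.symm]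
    change π (v - (π v : V)) = 0
    rw [map_sub, sub_eq_zero]
    exact (Submodule.projectionOnto_apply_left hU.symm (π v)).symm
  refine sInf_le ⟨_, rfl, fun i => B.coord i ∘ₗ π, fun i => LinearMap.BilinMap.toQuadraticMap
    (T (B i) + (T (B i)) ∘ₗ P + ((T (B i)) ∘ₗ P).compl₂ P), fun v => ?_⟩
  have hπ : (π v : V) = ∑ i, B.coord i (π v) • (B i : V) := by
    refine (congrArg Subtype.val (B.sum_repr (π v)).symm).trans ?_
    rw [Submodule.coe_sum]
    rfl
  have hv : v = P v + π v := by simp [P]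
  have key : T v v v = T (π v) v v + T (π v) (P v) v + T (π v) (P v) (P v) := by
    have h0 := hW _ (hP v)
    have hcube : ∀ p u : V, T p p p = 0 → T (p + u) (p + u) (p + u) =
        T u (p + u) (p + u) + T u p (p + u) + T u p p := by
      intro p u hp
      simp only [map_add, LinearMap.add_apply]
      linear_combination hp + hT₂ p p u + 2 * hT₁ p u p + hT₁ p u u
    have h1 := hcube _ (π v) h0
    rwa [← hv] at h1
  change T v v v = _
  rw [key, hπ]
  simp [Finset.sum_add_distrib, mul_add]

end CubicForm

theorem xi_mul_self_add_le (d : ℕ) : xi d * xi d + 3 * xi d ≤ 2 * d + 2 := by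
  have h0 : (0 : ℝ) ≤ (Real.sqrt (8 * (d : ℝ) + 17) - 3) / 2 := by
    have : (3 : ℝ) ≤ Real.sqrt (8 * (d : ℝ) + 17) := by
      apply Real.le_sqrt_of_sq_le
      have : (0 : ℝ) ≤ d := d.cast_nonneg
      linarith
    linarith
  have h1 : (xi d : ℝ) ≤ (Real.sqrt (8 * (d : ℝ) + 17) - 3) / 2 := Nat.floor_le h0
  have h2 : (2 * (xi d : ℝ) + 3) ^ 2 ≤ 8 * (d : ℝ) + 17 := by
    rw [← Real.le_sqrt (by positivity) (by positivity)]
    linarith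
  have h3 : ((xi d * xi d + 3 * xi d : ℕ) : ℝ) ≤ ((2 * d + 2 : ℕ) : ℝ) := by
    push_cast; linarith
  exact_mod_cast h3

/-- Bound on q-rank in terms of the dimension: `qrank f ≤ d − ξ(d)` when `dim V = d ≠ 1`. -/
theorem qrank_le_dim_sub_xi {k : Type*} [Field k] [IsAlgClosed k]
    (h2 : (2 : k) ≠ 0) (h3 : (3 : k) ≠ 0)
    {V : Type*} [AddCommGroup V] [Module k V] [FiniteDimensional k V]
    (d : ℕ) (hd : Module.finrank k V = d) (hd1 : d ≠ 1)
    (f : V → k) (hf : IsCubicForm k f) :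
    qrank k f ≤ ((d - xi d : ℕ) : ℕ∞) := by
  obtain ⟨T, hT₁, hT₂, hfT⟩ := hf
  obtain rfl : f = fun v => T v v v := funext hfT
  have hxi := xi_mul_self_add_le d
  have hle := xi_le d
  obtain ⟨w, hw, hw0⟩ : ∃ w : Fin (xi d) → V, LinearIndependent k w ∧
      ∀ i j l, T (w i) (w j) (w l) = 0 := by
    rcases Nat.lt_trichotomy (xi d) 1 with h | h | h
    · have h0 : xi d = 0 := by omega
      rw [h0]
      exact ⟨Fin.elim0, linearIndependent_empty_type, fun i => i.elim0⟩
    · obtain ⟨w, hw, hw0⟩ := exists_ne_zero_trilinear_eq_zero T (by omega)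
      rw [h]
      exact ⟨fun _ => w, (linearIndependent_unique_iff).2 hw, fun _ _ _ => hw0⟩
    · exact exists_linearIndependent_trilinear_eq_zero h2 h3 T hT₁ hT₂ h (by omega)
  subst hd
  exact qrank_le_of_linearIndependent T hT₁ hT₂ w hw hw0
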